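/- Let $r > 0$, $\varphi \in [0,\pi)$, write $e(\alpha) = (\cos\alpha, \sin\alpha)$, and let $u$ be the closed segment $[-\tfrac{r}{2}e(\varphi), \tfrac{r}{2}e(\varphi)]$. Let $f : [0,\pi) \to [0,\infty)$ be a measurable function integrable on $[0,\pi)$. Then $$\int_{[0,\pi)} \int_{\mathbb{R}^2} \mathbf{1}\Big[\big[y - \tfrac{r}{2}e(\beta), y + \tfrac{r}{2}e(\beta)\big] \cap u \neq \emptyset\Big]\, f(\beta)\, dy\, d\beta = r^2 \int_0^{\pi} |\sin(\beta - \varphi)|\, f(\beta)\, d\beta.$$ -/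

import Mathlib

open MeasureTheory
open scoped Classical

/-- The unit vector `e(α) = (cos α, sin α)` in the Euclidean plane. -/
noncomputable def dirVec (α : ℝ) : EuclideanSpace ℝ (Fin 2) :=
  (WithLp.equiv 2 (Fin 2 → ℝ)).symm ![Real.cos α, Real.sin α]

/-- A closed segment centred at `y` with half-direction `c • v` consists of the points `y + s • v`
with `|s| ≤ c`. -/
lemma mem_segment_sub_add_iff {E : Type*} [AddCommGroup E] [Module ℝ E] {c : ℝ} (hc : 0 < c)
    (y v x : E) :
    x ∈ segment ℝ (y - c • v) (y + c • v) ↔ ∃ s ∈ Set.Icc (-c) c, x = y + s • v := by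
  rw [segment_eq_image]
  constructor
  · rintro ⟨t, ⟨h0, h1⟩, rfl⟩
    refine ⟨(2 * t - 1) * c, ⟨by nlinarith, by nlinarith⟩, by module⟩
  · rintro ⟨s, ⟨h0, h1⟩, rfl⟩
    refine ⟨(s / c + 1) / 2, ⟨?_, ?_⟩, ?_⟩
    · have : -1 ≤ s / c := by rw [le_div_iff₀ hc]; linarith
      linarith
    · have : s / c ≤ 1 := by rw [div_le_iff₀ hc]; linarith
      linarith
    · obtain ⟨k, rfl⟩ : ∃ k, s = k * c := ⟨s / c, by field_simp⟩
      rw [mul_div_assoc, div_self hc.ne']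
      module

/-- The linear map sending the standard basis vectors to `dirVec β` and `dirVec φ`. -/
noncomputable def dirMap (β φ : ℝ) : EuclideanSpace ℝ (Fin 2) →ₗ[ℝ] EuclideanSpace ℝ (Fin 2) :=
  Matrix.toLpLin 2 2 !![Real.cos β, Real.cos φ; Real.sin β, Real.sin φ]

lemma dirMap_apply (β φ : ℝ) (v : EuclideanSpace ℝ (Fin 2)) :
    dirMap β φ v = v 0 • dirVec β + v 1 • dirVec φ := by
  ext i
  fin_cases i <;> simp [dirMap, dirVec, Matrix.mulVec, dotProduct, Fin.sum_univ_two, mul_comm]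

lemma det_dirMap (β φ : ℝ) : LinearMap.det (dirMap β φ) = -Real.sin (β - φ) := by
  rw [dirMap, Matrix.toLpLin_eq_toLin, LinearMap.det_toLin, Matrix.det_fin_two_of,
    Real.sin_sub]
  ring

/-- The centred closed square of side `2 * c`. -/
def centredSquare (c : ℝ) : Set (EuclideanSpace ℝ (Fin 2)) :=
  WithLp.ofLp ⁻¹' Set.Icc (fun _ => -c) (fun _ => c)

lemma mem_centredSquare {c : ℝ} {v : EuclideanSpace ℝ (Fin 2)} :
    v ∈ centredSquare c ↔ ∀ i, v i ∈ Set.Icc (-c) c := by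
  simp [centredSquare, Pi.le_def, forall_and]

lemma volume_centredSquare (c : ℝ) :
    volume (centredSquare c) = ENNReal.ofReal (2 * c) ^ 2 := by
  rw [centredSquare, (PiLp.volume_preserving_ofLp (Fin 2)).measure_preimage
    measurableSet_Icc.nullMeasurableSet, Real.volume_Icc_pi]
  simp [two_mul]

lemma isCompact_centredSquare (c : ℝ) : IsCompact (centredSquare c) :=
  (PiLp.homeomorph 2 (fun _ : Fin 2 => ℝ)).isCompact_preimage.2 isCompact_Icc

/-- The centres of the segments of direction `β` hitting the centred segment of direction `φ`
form a parallelogram. -/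
lemma setOf_segment_inter_nonempty {c : ℝ} (hc : 0 < c) (β φ : ℝ) :
    {y : EuclideanSpace ℝ (Fin 2) | (segment ℝ (y - c • dirVec β) (y + c • dirVec β) ∩
      segment ℝ (-(c • dirVec φ)) (c • dirVec φ)).Nonempty} =
      dirMap β φ '' centredSquare c := by
  ext y
  have hseg : segment ℝ (-(c • dirVec φ)) (c • dirVec φ) =
      segment ℝ (0 - c • dirVec φ) (0 + c • dirVec φ) := by simp
  simp only [hseg, Set.mem_ofPred_eq, Set.Nonempty, Set.mem_inter_iff,
    mem_segment_sub_add_iff hc, Set.mem_image, mem_centredSquare, dirMap_apply]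
  constructor
  · rintro ⟨x, ⟨s, hs, hx⟩, t, ht, hxt⟩
    refine ⟨!₂[-s, t], ?_, ?_⟩
    · intro i
      fin_cases i
      · exact ⟨by simpa using hs.2, by simpa using neg_le.1 hs.1⟩
      · simpa using ht
    · have : y = t • dirVec φ - s • dirVec β := by
        rw [eq_sub_iff_add_eq, ← hx, hxt, zero_add]
      rw [this]
      simp
      abel
  · rintro ⟨v, hv, rfl⟩
    refine ⟨v 1 • dirVec φ, ⟨-v 0, ⟨neg_le_neg (hv 0).2, neg_le.1 (hv 0).1⟩, by module⟩,
      v 1, hv 1, by simp⟩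

lemma measurableSet_dirMap_image (β φ c : ℝ) :
    MeasurableSet (dirMap β φ '' centredSquare c) :=
  ((isCompact_centredSquare c).image
    (LinearMap.continuous_of_finiteDimensional _)).measurableSet

lemma measureReal_dirMap_image {c : ℝ} (hc : 0 ≤ c) (β φ : ℝ) :
    volume.real (dirMap β φ '' centredSquare c) = (2 * c) ^ 2 * |Real.sin (β - φ)| := by
  rw [measureReal_def, Measure.addHaar_image_linearMap, det_dirMap, volume_centredSquare, abs_neg,
    ENNReal.toReal_mul, ENNReal.toReal_pow, ENNReal.toReal_ofReal (abs_nonneg _),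
    ENNReal.toReal_ofReal (by positivity), mul_comm]

/-- the identity `∫ 1[x ↑ u] f(β) dx = r² ∫ |sin(β-φ)| f(β) dβ`
of Section 4 of the paper.
For a fixed segment `u = [-(r/2)e(φ), (r/2)e(φ)]` of length `r` and direction `φ`,
and `f : [0,π) → [0,∞)` measurable and integrable,
`∫_{[0,π)} ∫_{ℝ²} 1[segment of direction β centred at y hits u] f(β) dy dβ
  = r² ∫₀^π |sin(β - φ)| f(β) dβ`. -/
theorem stmt6 (r : ℝ) (hr : 0 < r) (φ : ℝ) (hφ : φ ∈ Set.Ico (0 : ℝ) Real.pi)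
    (f : ℝ → ℝ) (hfmeas : Measurable f) (hfnonneg : ∀ β, 0 ≤ f β)
    (hfint : IntegrableOn f (Set.Ico (0 : ℝ) Real.pi)) :
    (∫ β in Set.Ico (0 : ℝ) Real.pi, ∫ y : EuclideanSpace ℝ (Fin 2),
        (if (segment ℝ (y - (r / 2) • dirVec β) (y + (r / 2) • dirVec β) ∩
              segment ℝ (-((r / 2) • dirVec φ)) ((r / 2) • dirVec φ)).Nonempty
          then f β else 0))
      = r ^ 2 * ∫ β in (0 : ℝ)..Real.pi, |Real.sin (β - φ)| * f β := by
  have hinner (β : ℝ) : (∫ y : EuclideanSpace ℝ (Fin 2),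
      (if (segment ℝ (y - (r / 2) • dirVec β) (y + (r / 2) • dirVec β) ∩
            segment ℝ (-((r / 2) • dirVec φ)) ((r / 2) • dirVec φ)).Nonempty
        then f β else 0)) = r ^ 2 * (|Real.sin (β - φ)| * f β) := by
    have hr2 : 0 < r / 2 := by positivity
    have h := integral_indicator_const (μ := volume) (f β)
      (measurableSet_dirMap_image β φ (r / 2))
    rw [measureReal_dirMap_image hr2.le, ← setOf_segment_inter_nonempty hr2, smul_eq_mul,
      mul_div_cancel₀ r two_ne_zero, mul_assoc] at h
    rw [← h]
    rfl
  simp_rw [hinner]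
  rw [integral_const_mul, intervalIntegral.integral_of_le Real.pi_pos.le,
    integral_Ico_eq_integral_Ioc]
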